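/- Let N ≥ 1 and ε ∈ (0,1), ζ > 0 be given. There exists a finite threshold W̄ such that for any nonnegative reals W_1, …, W_N with W* = max_l W_l > W̄, the distribution π_l = (exp(W_l)/Z)(1 − 1/Z), where Z = Σ_{j=1}^N exp(W_j), satisfies the expected-weight lower bound Σ_{l=1}^N π_l · W_l ≥ (1 − ε)(1 − ζ) W*. -/

import Mathlib

/-- The average of `W` under its Gibbs distribution is at least `M - card ι` whenever `exp M` is
bounded by the partition function. -/
theorem sum_exp_mul_ge {ι : Type*} [Fintype ι] (W : ι → ℝ) (M : ℝ)
    (hM : Real.exp M ≤ ∑ j, Real.exp (W j)) :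
    (∑ j, Real.exp (W j)) * (M - Fintype.card ι) ≤ ∑ j, Real.exp (W j) * W j := by
  have hterm (j : ι) : Real.exp (W j) * M - Real.exp M ≤ Real.exp (W j) * W j := by
    have h := Real.add_one_le_exp (M - W j)
    have hexp : Real.exp M = Real.exp (W j) * Real.exp (M - W j) := by
      rw [← Real.exp_add, add_sub_cancel]
    rw [hexp]
    nlinarith [Real.exp_pos (W j)]
  have hsum := Finset.sum_le_sum fun j (_ : j ∈ Finset.univ) => hterm j
  rw [Finset.sum_sub_distrib, ← Finset.sum_mul, Finset.sum_const, Finset.card_univ,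
    nsmul_eq_mul] at hsum
  nlinarith [mul_le_mul_of_nonneg_left hM (Nat.cast_nonneg (α := ℝ) (Fintype.card ι))]


/-- Let `N ≥ 1` and `ε ∈ (0,1)`, `ζ > 0` be given.  There exists a finite
threshold `Wbar` such that for any nonnegative reals `W 0, …, W (N-1)` with
`Wstar = max_l W l > Wbar`, the distribution `π l = (exp (W l) / Z) * (1 - 1 / Z)`,
where `Z = ∑ j, exp (W j)`, satisfies the expected-weight lower bound
`∑ l, π l * W l ≥ (1 - ε) * (1 - ζ) * Wstar`. -/
theorem fcsma_expected_weight_lower_bound (N : ℕ) (hN : 1 ≤ N)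
    (ε : ℝ) (hε : ε ∈ Set.Ioo (0 : ℝ) 1) (ζ : ℝ) (hζ : 0 < ζ) :
    ∃ Wbar : ℝ, ∀ W : Fin N → ℝ, (∀ l, 0 ≤ W l) →
      ∀ Wstar : ℝ, Wstar = ⨆ l, W l → Wstar > Wbar →
      ∀ Z : ℝ, Z = ∑ j, Real.exp (W j) →
      (1 - ε) * (1 - ζ) * Wstar ≤
        ∑ l, (Real.exp (W l) / Z) * (1 - 1 / Z) * W l := by
  obtain ⟨hε0, hε1⟩ := hε
  refine ⟨(N + 1) / ε, fun W _ M hM hlt Z hZ => ?_⟩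
  have : Nonempty (Fin N) := ⟨⟨0, hN⟩⟩
  obtain ⟨l, hl⟩ := exists_eq_ciSup_of_finite (f := W)
  have hMZ : Real.exp M ≤ Z := by
    rw [hZ, hM, ← hl]
    exact Finset.single_le_sum (f := fun j => Real.exp (W j))
      (fun j _ => (Real.exp_pos _).le) (Finset.mem_univ l)
  have hZ0 : 0 < Z := (Real.exp_pos M).trans_le hMZ
  have hεM : N + 1 < M * ε := (div_lt_iff₀ hε0).mp hlt
  have hN0 : (0 : ℝ) ≤ N := Nat.cast_nonneg N
  have hM0 : 0 < M := lt_trans (by positivity) hlt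
  have hZM : M + 1 ≤ Z := (Real.add_one_le_exp M).trans hMZ
  have hmean : M - N ≤ (∑ j, Real.exp (W j) * W j) / Z := by
    have h := sum_exp_mul_ge W M (hZ ▸ hMZ)
    rw [← hZ, Fintype.card_fin] at h
    rw [le_div_iff₀ hZ0]
    linarith
  have hfactor : 0 ≤ 1 - 1 / Z := by
    rw [sub_nonneg, div_le_one hZ0]
    linarith
  have hMdiv : M / Z ≤ 1 := by
    rw [div_le_one hZ0]
    linarith
  have hNdiv : 0 ≤ N / Z := by positivity
  calc (1 - ε) * (1 - ζ) * M ≤ (1 - ε) * M := by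
        nlinarith [mul_pos (mul_pos (sub_pos.mpr hε1) hζ) hM0]
    _ ≤ M - N - M / Z + N / Z := by linarith
    _ = (1 - 1 / Z) * (M - N) := by ring
    _ ≤ (1 - 1 / Z) * ((∑ j, Real.exp (W j) * W j) / Z) :=
        mul_le_mul_of_nonneg_left hmean hfactor
    _ = ∑ l, (Real.exp (W l) / Z) * (1 - 1 / Z) * W l := by
        rw [Finset.sum_div, Finset.mul_sum]
        exact Finset.sum_congr rfl fun j _ => by ring
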